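/- arXiv:math/0412322 — 2 statements merged into one kernel-verified Lean document; each statement's English description precedes it below -/
import Mathlib

section
/- Let α ∈ (0, 1/2], let Π be a measure on (0,∞) with ∫_{(0,∞)} min(x, x²) Π(dx) < ∞, and let p : (0,∞) × (0,∞) → [0,∞) be jointly measurable, continuous in its second argument, and satisfy ∫₀^∞ e^{−qt} p(x,t) dt = exp(−x q^α) for all x, q > 0. Define ν(t) = ∫_{(0,∞)} ( (α/Γ(1−α)) x t^{−(1+α)} − p(x,t) ) Π(dx) for t > 0. Then ν(t) ≥ 0 for all t > 0, and for every q > 0, ∫₀^∞ (1 − e^{−qt}) ν(t) dt = ∫_{(0,∞)} (e^{−q^α x} − 1 + q^α x) Π(dx), which is finite. In particular ν is the Lévy measure density of the Bernstein function q ↦ Ψ_{0,0,Π}(q^α), where Ψ_{0,0,Π}(q) = ∫_{(0,∞)} (e^{−qx} − 1 + qx) Π(dx). -/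
open MeasureTheory Real Set

noncomputable section

/-- A Bernstein function: infinitely differentiable on `(0,∞)`, nonnegative there,
and `(-1)^(n-1) f^(n)(q) ≥ 0` for all `n ≥ 1` and `q > 0`. -/
def IsBernstein (f : ℝ → ℝ) : Prop :=
  ContDiffOn ℝ (⊤ : ℕ∞) f (Ioi 0) ∧
  (∀ q > (0:ℝ), 0 ≤ f q) ∧
  ∀ n : ℕ, 1 ≤ n → ∀ q > (0:ℝ), 0 ≤ (-1 : ℝ) ^ (n - 1) * iteratedDerivWithin n f (Ioi 0) q

/-- A completely monotone function: infinitely differentiable on `(0,∞)` with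
`(-1)^n f^(n)(q) ≥ 0` for all `n ≥ 0` and `q > 0`. -/
def IsCompletelyMonotone (f : ℝ → ℝ) : Prop :=
  ContDiffOn ℝ (⊤ : ℕ∞) f (Ioi 0) ∧
  ∀ n : ℕ, ∀ q > (0:ℝ), 0 ≤ (-1 : ℝ) ^ n * iteratedDerivWithin n f (Ioi 0) q

/-- A (sub)critical branching mechanism:
`Ψ q = a q + b q² + ∫_{(0,∞)} (e^(-qx) - 1 + qx) Pi(dx)` with `a, b ≥ 0` and
`∫ min(x, x²) Pi(dx) < ∞` (`Pi` a measure carried by `(0,∞)`). -/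
def IsBranchingMechanism (Ψ : ℝ → ℝ) : Prop :=
  ∃ (a b : ℝ) (Pi : Measure ℝ), 0 ≤ a ∧ 0 ≤ b ∧ Pi (Iic 0) = 0 ∧
    (∫⁻ x, ENNReal.ofReal (min x (x ^ 2)) ∂Pi) < ⊤ ∧
    ∀ q > (0:ℝ), Ψ q = a * q + b * q ^ 2 + ∫ x, (Real.exp (-q * x) - 1 + q * x) ∂Pi

lemma uniq_fin (μ μ' : Measure ℝ) [IsFiniteMeasure μ] [IsFiniteMeasure μ']
    (h1 : ∀ s < (1:ℝ), Integrable (fun t => Real.exp (s * t)) μ)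
    (h2 : ∀ s < (1:ℝ), Integrable (fun t => Real.exp (s * t)) μ')
    (h : ∀ s < (1:ℝ), ∫ t, Real.exp (s * t) ∂μ = ∫ t, Real.exp (s * t) ∂μ') : μ = μ' := by
  have hs : ∀ (m : Measure ℝ), (∀ s < (1:ℝ), Integrable (fun t => Real.exp (s * t)) m) →
      Iio (1:ℝ) ⊆ interior (ProbabilityTheory.integrableExpSet id m) := by
    intro m hm
    apply interior_maximal _ isOpen_Iio
    intro s hs
    exact hm s hs
  have hX : AnalyticOnNhd ℂ (ProbabilityTheory.complexMGF id μ) {z | z.re ∈ Iio (1:ℝ)} :=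
    ProbabilityTheory.analyticOnNhd_complexMGF.mono (fun z hz => hs μ h1 hz)
  have hY : AnalyticOnNhd ℂ (ProbabilityTheory.complexMGF id μ') {z | z.re ∈ Iio (1:ℝ)} :=
    ProbabilityTheory.analyticOnNhd_complexMGF.mono (fun z hz => hs μ' h2 hz)
  have key : EqOn (ProbabilityTheory.complexMGF id μ) (ProbabilityTheory.complexMGF id μ')
      {z | z.re ∈ Iio (1:ℝ)} := by
    refine AnalyticOnNhd.eqOn_of_preconnected_of_frequently_eq hX hY
      ((convex_Iio (1:ℝ)).linear_preimage Complex.reLm).isPreconnected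
      (z₀ := ((0:ℝ) : ℂ)) (by simp) ?_
    have h_real : ∃ᶠ (x : ℝ) in nhdsWithin 0 {0}ᶜ,
        ProbabilityTheory.complexMGF id μ x = ProbabilityTheory.complexMGF id μ' x := by
      apply Filter.Eventually.frequently
      apply Filter.Eventually.filter_mono nhdsWithin_le_nhds
      filter_upwards [Iio_mem_nhds (show (0:ℝ) < 1 by norm_num)] with y hy
      rw [ProbabilityTheory.complexMGF_ofReal, ProbabilityTheory.complexMGF_ofReal]
      congr 1
      exact h y hy
    rw [Filter.frequently_iff_seq_forall] at h_real ⊢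
    obtain ⟨xs, hx_tendsto, hx_eq⟩ := h_real
    refine ⟨fun n ↦ xs n, ?_, fun n ↦ ?_⟩
    · rw [tendsto_nhdsWithin_iff] at hx_tendsto ⊢
      constructor
      · rw [Filter.tendsto_ofReal_iff]
        exact hx_tendsto.1
      · simpa using hx_tendsto.2
    · simp [hx_eq]
  apply Measure.ext_of_charFun
  ext t
  have := key (x := (t:ℂ) * Complex.I) (by simp)
  rw [charFun_apply_real, charFun_apply_real]
  simp only [ProbabilityTheory.complexMGF, id] at this
  convert this using 3 <;> ring_nf

def LapT (μ : Measure ℝ) (q : ℝ) : ENNReal := ∫⁻ t, ENNReal.ofReal (Real.exp (-q * t)) ∂μ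

lemma uniq (μ μ' : Measure ℝ) (h : ∀ q > 0, LapT μ q = LapT μ' q) (hf : ∀ q > 0, LapT μ q < ⊤) :
    μ = μ' := by
  set E : ℝ → ENNReal := fun t => ENNReal.ofReal (Real.exp (-t)) with hE
  have hEm : Measurable E := by fun_prop
  have hl : ∀ (m : Measure ℝ) (s : ℝ), ∫⁻ t, ENNReal.ofReal (Real.exp (s * t)) ∂(m.withDensity E)
      = LapT m (1 - s) := by
    intro m s
    rw [lintegral_withDensity_eq_lintegral_mul _ hEm (by fun_prop), LapT]
    congr with t
    simp only [Pi.mul_apply, hE]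
    rw [← ENNReal.ofReal_mul (by positivity), ← Real.exp_add]
    congr 2; ring
  have hint : ∀ (m : Measure ℝ) (_ : ∀ q > 0, LapT m q < ⊤) (s : ℝ) (_ : s < 1),
      Integrable (fun t => Real.exp (s * t)) (m.withDensity E) := by
    intro m hm s hs
    refine ⟨by fun_prop, ?_⟩
    rw [hasFiniteIntegral_iff_ofReal (Filter.Eventually.of_forall fun t => by positivity), hl]
    exact hm _ (by linarith)
  have hf' : ∀ q > 0, LapT μ' q < ⊤ := fun q hq => h q hq ▸ hf q hq
  have hfin : ∀ (m : Measure ℝ) (_ : ∀ q > 0, LapT m q < ⊤), IsFiniteMeasure (m.withDensity E) := by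
    intro m hm
    have := hint m hm 0 (by norm_num)
    simp only [zero_mul, Real.exp_zero] at this
    exact (integrable_const_iff_isFiniteMeasure one_ne_zero).1 this
  have := hfin μ hf
  have := hfin μ' hf'
  have key : μ.withDensity E = μ'.withDensity E := by
    apply uniq_fin _ _ (hint μ hf) (hint μ' hf')
    intro s hs
    rw [integral_eq_lintegral_of_nonneg_ae (Filter.Eventually.of_forall fun t => by positivity)
      (by fun_prop), integral_eq_lintegral_of_nonneg_ae
      (Filter.Eventually.of_forall fun t => by positivity) (by fun_prop), hl, hl,
      h _ (by linarith)]
  have h0 : ∀ m : Measure ℝ, (m.withDensity E).withDensity (fun t => (E t)⁻¹) = m := by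
    intro m
    apply withDensity_inv_same hEm
    · filter_upwards with t
      simp [hE, Real.exp_pos]
    · filter_upwards with t
      simp [hE]
  rw [← h0 μ, ← h0 μ', key]

lemma lapl_rpow (a q : ℝ) (ha : 0 < a) (hq : 0 < q) :
    ∫⁻ t in Ioi (0:ℝ), ENNReal.ofReal (t ^ (a - 1)) * ENNReal.ofReal (Real.exp (-q * t))
      = ENNReal.ofReal (q ^ (-a) * Real.Gamma a) := by
  have h := Real.integral_rpow_mul_exp_neg_mul_Ioi ha hq
  have hpos : 0 < (1 / q) ^ a * Real.Gamma a := by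
    have := Real.Gamma_pos_of_pos ha
    positivity
  have hint : IntegrableOn (fun t : ℝ => t ^ (a - 1) * Real.exp (-(q * t))) (Ioi 0) := by
    apply Integrable.of_integral_ne_zero
    rw [h]; exact hpos.ne'
  have e : q ^ (-a) = (1 / q) ^ a := by
    rw [Real.rpow_neg hq.le, one_div, Real.inv_rpow hq.le]
  rw [e, ← h, ofReal_integral_eq_lintegral_ofReal hint]
  · apply setLIntegral_congr_fun measurableSet_Ioi
    intro t ht
    have : (0:ℝ) ≤ t ^ (a-1) := Real.rpow_nonneg (le_of_lt ht) _
    simp only []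
    rw [← ENNReal.ofReal_mul this, neg_mul]
  · filter_upwards [ae_restrict_mem measurableSet_Ioi] with t ht
    have : (0:ℝ) ≤ t ^ (a-1) := Real.rpow_nonneg (le_of_lt ht) _
    positivity

lemma lapl_tp (α x : ℝ) (hα : 0 < α) (hx : 0 < x) (f : ℝ → ℝ) (hf : Measurable f)
    (hf0 : ∀ t > 0, 0 ≤ f t)
    (hlap : ∀ q > (0:ℝ), (∫ t in Ioi (0:ℝ), Real.exp (-q * t) * f t) = Real.exp (-x * q ^ α))
    (q : ℝ) (hq : 0 < q) :
    ∫⁻ t in Ioi (0:ℝ), ENNReal.ofReal (t * f t) * ENNReal.ofReal (Real.exp (-q * t)) =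
      ENNReal.ofReal (α * x * q ^ (α - 1) * Real.exp (-x * q ^ α)) := by
  set m : Measure ℝ := (volume.restrict (Ioi (0:ℝ))).withDensity (fun t => ENNReal.ofReal (f t))
    with hm
  have hconv : ∀ g : ℝ → ℝ, ∫ t, g t ∂m = ∫ t in Ioi (0:ℝ), f t * g t := by
    intro g
    rw [hm, integral_withDensity_eq_integral_toReal_smul (by fun_prop)
      (Filter.Eventually.of_forall fun t => by simp)]
    apply setIntegral_congr_fun measurableSet_Ioi
    intro t ht
    simp [ENNReal.toReal_ofReal (hf0 t ht)]
  have hmgf : ∀ s < (0:ℝ), ProbabilityTheory.mgf id m s = Real.exp (-x * (-s) ^ α) := by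
    intro s hs
    rw [ProbabilityTheory.mgf, hconv, ← hlap (-s) (by linarith)]
    congr with t
    simp [mul_comm]
  have hsub : Iio (0:ℝ) ⊆ interior (ProbabilityTheory.integrableExpSet id m) := by
    apply interior_maximal _ isOpen_Iio
    intro s hs
    apply Integrable.of_integral_ne_zero
    have := hmgf s hs
    rw [ProbabilityTheory.mgf] at this
    rw [this]
    positivity
  have hd := ProbabilityTheory.hasDerivAt_mgf (hsub (show -q ∈ Iio (0:ℝ) by simpa using hq))
  have hd2 : HasDerivAt (fun s : ℝ => Real.exp (-x * (-s) ^ α))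
      (α * x * q ^ (α - 1) * Real.exp (-x * q ^ α)) (-q) := by
    have h1 : HasDerivAt (fun s : ℝ => -s) (-1) (-q) := (hasDerivAt_id _).neg
    have h2 := h1.rpow_const (p := α) (Or.inl (by simpa using hq.ne'))
    have h3 := (h2.const_mul (-x)).exp
    convert h3 using 1
    simp; ring
  have heq : ProbabilityTheory.mgf id m =ᶠ[nhds (-q)] (fun s : ℝ => Real.exp (-x * (-s) ^ α)) := by
    filter_upwards [Iio_mem_nhds (show -q < 0 by linarith)] with s hs using hmgf s hs
  have hv := hd.unique (hd2.congr_of_eventuallyEq heq)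
  simp only [id] at hv
  rw [hconv] at hv
  rw [← hv, ofReal_integral_eq_lintegral_ofReal]
  · apply setLIntegral_congr_fun measurableSet_Ioi
    intro t ht
    have h1 := hf0 t ht
    have h2 : (0:ℝ) < t := ht
    simp only []
    rw [← ENNReal.ofReal_mul (by positivity)]
    congr 1; ring
  · apply Integrable.of_integral_ne_zero
    rw [hv]; positivity
  · filter_upwards [ae_restrict_mem measurableSet_Ioi] with t ht
    have h1 := hf0 t ht
    have h2 : (0:ℝ) < t := ht
    simp only [Pi.zero_apply]
    positivity

lemma lint_exp_Ioc (k b : ℝ) (hk : k ≠ 0) (hb : 0 ≤ b) :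
    ∫⁻ y in Ioc 0 b, ENNReal.ofReal (Real.exp (-y * k)) =
      ENNReal.ofReal ((1 - Real.exp (-b * k)) / k) := by
  have hc : Continuous (fun y : ℝ => Real.exp (-y * k)) := by fun_prop
  rw [← ofReal_integral_eq_lintegral_ofReal (hc.integrableOn_Ioc)
    (Filter.Eventually.of_forall fun t => by positivity), ← intervalIntegral.integral_of_le hb]
  congr 1
  rw [intervalIntegral.integral_eq_sub_of_hasDerivAt
    (f := fun y => - Real.exp (-y * k) / k) (f' := fun y => Real.exp (-y * k))]
  · simp; ring
  · intro y _
    have h1 : HasDerivAt (fun s : ℝ => -s * k) (-1 * k) y := ((hasDerivAt_id _).neg).mul_const k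
    have h2 := (h1.exp.neg).div_const k
    have e : Real.exp (-y * k) = -(Real.exp (-y * k) * (-1 * k)) / k := by field_simp
    rw [e]; exact h2
  · exact hc.intervalIntegrable _ _

lemma exists_C (α x : ℝ) (hα : α ∈ Set.Ioc (0:ℝ) (1/2)) (hx : 0 < x) (p : ℝ → ℝ → ℝ)
    (hp_meas : Measurable (Function.uncurry p))
    (hp_nonneg : ∀ x > (0:ℝ), ∀ t > (0:ℝ), 0 ≤ p x t)
    (hp_lap : ∀ x > (0:ℝ), ∀ q > (0:ℝ),
      (∫ t in Ioi (0:ℝ), Real.exp (-q * t) * p x t) = Real.exp (-x * q ^ α)) :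
    ∃ C : Measure ℝ, ∀ q > 0, LapT C q =
      ENNReal.ofReal (α * x * q ^ (α - 1) * (1 - Real.exp (-x * q ^ α))) := by
  obtain ⟨hα0, hα1⟩ := hα
  set M1 : Measure ℝ := (((volume.restrict (Ioc 0 x)).prod (volume.restrict (Ioi 0))).withDensity
    (fun z : ℝ × ℝ => ENNReal.ofReal (p z.1 z.2))).map Prod.snd with hM1
  have hpm : Measurable (fun z : ℝ × ℝ => ENNReal.ofReal (p z.1 z.2)) :=
    hp_meas.ennreal_ofReal
  have L1 : ∀ q > 0, LapT M1 q = ENNReal.ofReal ((1 - Real.exp (-x * q ^ α)) / q ^ α) := by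
    intro q hq
    rw [LapT, hM1, lintegral_map (by fun_prop) measurable_snd,
      lintegral_withDensity_eq_lintegral_mul _ hpm (by fun_prop), lintegral_prod _
      (by simp only [Pi.mul_def]; fun_prop), ← lint_exp_Ioc (q ^ α) x (by positivity) hx.le]
    apply setLIntegral_congr_fun measurableSet_Ioc
    intro y hy
    simp only []
    have hy0 : 0 < y := hy.1
    rw [← hp_lap y hy0 q hq, ofReal_integral_eq_lintegral_ofReal]
    · apply setLIntegral_congr_fun measurableSet_Ioi
      intro t ht
      have h1 := hp_nonneg y hy0 t ht
      simp only [Pi.mul_apply]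
      rw [← ENNReal.ofReal_mul h1, mul_comm]
    · apply Integrable.of_integral_ne_zero
      rw [hp_lap y hy0 q hq]; positivity
    · filter_upwards [ae_restrict_mem measurableSet_Ioi] with t ht
      have h1 := hp_nonneg y hy0 t ht
      simp only [Pi.zero_apply]
      positivity
  have L2 : ∃ M2 : Measure ℝ, SFinite M2 ∧ ∀ q > 0, LapT M2 q = ENNReal.ofReal (q ^ (2 * α - 1)) := by
    rcases eq_or_lt_of_le hα1 with h | h
    · refine ⟨Measure.dirac 0, inferInstance, fun q hq => ?_⟩
      simp [LapT, h]
    · refine ⟨(volume.restrict (Ioi (0:ℝ))).withDensity (fun t => ENNReal.ofReal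
        ((Real.Gamma (1 - 2 * α))⁻¹) * ENNReal.ofReal (t ^ (1 - 2 * α - 1))), inferInstance, ?_⟩
      intro q hq
      have hG : 0 < Real.Gamma (1 - 2 * α) := Real.Gamma_pos_of_pos (by linarith)
      rw [LapT, lintegral_withDensity_eq_lintegral_mul _ (by fun_prop) (by fun_prop)]
      simp only [Pi.mul_apply, mul_assoc]
      rw [lintegral_const_mul _ (by fun_prop), lapl_rpow _ _ (by linarith) hq,
        ← ENNReal.ofReal_mul (by positivity)]
      congr 1
      rw [mul_comm, mul_assoc, mul_inv_cancel₀ hG.ne', mul_one]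
      congr 1; ring
  obtain ⟨M2, hS, L2⟩ := L2
  refine ⟨ENNReal.ofReal (α * x) • (M1.conv M2), fun q hq => ?_⟩
  rw [LapT, lintegral_smul_measure, Measure.lintegral_conv (by fun_prop)]
  have : ∀ s : ℝ, ∫⁻ t, ENNReal.ofReal (Real.exp (-q * (s + t))) ∂M2 =
      ENNReal.ofReal (Real.exp (-q * s)) * ENNReal.ofReal (q ^ (2 * α - 1)) := by
    intro s
    rw [← L2 q hq, LapT, ← lintegral_const_mul _ (by fun_prop)]
    congr with t
    rw [← ENNReal.ofReal_mul (by positivity), ← Real.exp_add, mul_add]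
  simp_rw [this]
  rw [lintegral_mul_const _ (by fun_prop)]
  have := L1 q hq
  rw [LapT] at this
  have he : 0 ≤ 1 - Real.exp (-x * q ^ α) := by
    have : Real.exp (-x * q ^ α) ≤ 1 := by
      rw [Real.exp_le_one_iff]
      have : 0 < x * q ^ α := by positivity
      linarith
    linarith
  rw [this, smul_eq_mul, ← ENNReal.ofReal_mul (by positivity), ← ENNReal.ofReal_mul (by positivity)]
  congr 1
  have : q ^ (α - 1) * q ^ α = q ^ (2 * α - 1) := by
    rw [← Real.rpow_add hq]; congr 1; ring
  rw [← this]
  have : q ^ α ≠ 0 := by positivity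
  field_simp

lemma lapl_B (α x q : ℝ) (hα : α ∈ Set.Ioc (0:ℝ) (1/2)) (hx : 0 < x) (hq : 0 < q) :
    ∫⁻ t in Ioi (0:ℝ), ENNReal.ofReal (α / Real.Gamma (1 - α) * x * t ^ (-α)) *
      ENNReal.ofReal (Real.exp (-q * t)) = ENNReal.ofReal (α * x * q ^ (α - 1)) := by
  obtain ⟨hα0, hα1⟩ := hα
  have hG : 0 < Real.Gamma (1 - α) := Real.Gamma_pos_of_pos (by linarith)
  have h := lapl_rpow (1 - α) q (by linarith) hq
  rw [show 1 - α - 1 = -α by ring] at h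
  simp_rw [ENNReal.ofReal_mul (show 0 ≤ α / Real.Gamma (1 - α) * x by positivity), mul_assoc]
  rw [lintegral_const_mul _ (by fun_prop), h, ← ENNReal.ofReal_mul (by positivity)]
  congr 1
  rw [show -(1 - α) = α - 1 by ring]
  field_simp

lemma p_bound (α x : ℝ) (hα : α ∈ Set.Ioc (0:ℝ) (1/2)) (hx : 0 < x) (p : ℝ → ℝ → ℝ)
    (hp_meas : Measurable (Function.uncurry p))
    (hp_cont : ∀ x > (0:ℝ), ContinuousOn (p x) (Ioi 0))
    (hp_nonneg : ∀ x > (0:ℝ), ∀ t > (0:ℝ), 0 ≤ p x t)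
    (hp_lap : ∀ x > (0:ℝ), ∀ q > (0:ℝ),
      (∫ t in Ioi (0:ℝ), Real.exp (-q * t) * p x t) = Real.exp (-x * q ^ α)) :
    ∀ t > 0, t * p x t ≤ α / Real.Gamma (1 - α) * x * t ^ (-α) := by
  have hG : 0 < Real.Gamma (1 - α) := Real.Gamma_pos_of_pos (by linarith [hα.2])
  have hα0 := hα.1
  have hpx : Measurable (p x) := hp_meas.of_uncurry_left
  obtain ⟨C, hC⟩ := exists_C α x hα hx p hp_meas hp_nonneg hp_lap
  set V := volume.restrict (Ioi (0:ℝ)) with hV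
  set fA : ℝ → ENNReal := fun t => ENNReal.ofReal (t * p x t) with hfA
  set fB : ℝ → ENNReal := fun t => ENNReal.ofReal (α / Real.Gamma (1 - α) * x * t ^ (-α)) with hfB
  have hfAm : Measurable fA := by fun_prop
  have hfBm : Measurable fB := by fun_prop
  have hA : ∀ q > 0, LapT (V.withDensity fA) q =
      ENNReal.ofReal (α * x * q ^ (α - 1) * Real.exp (-x * q ^ α)) := by
    intro q hq
    rw [LapT, lintegral_withDensity_eq_lintegral_mul _ hfAm (by fun_prop)]
    exact lapl_tp α x hα0 hx (p x) hpx (hp_nonneg x hx) (hp_lap x hx) q hq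
  have hB : ∀ q > 0, LapT (V.withDensity fB) q = ENNReal.ofReal (α * x * q ^ (α - 1)) := by
    intro q hq
    rw [LapT, lintegral_withDensity_eq_lintegral_mul _ hfBm (by fun_prop)]
    exact lapl_B α x q hα hx hq
  have heq : V.withDensity fB = V.withDensity fA + C := by
    apply uniq
    · intro q hq
      have he : 0 ≤ 1 - Real.exp (-x * q ^ α) := by
        have : Real.exp (-x * q ^ α) ≤ 1 := by
          rw [Real.exp_le_one_iff]
          have : 0 < x * q ^ α := by positivity
          linarith
        linarith
      rw [hB q hq, LapT, lintegral_add_measure]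
      have h1 := hA q hq
      have h2 := hC q hq
      rw [LapT] at h1 h2
      rw [h1, h2, ← ENNReal.ofReal_add (by positivity) (by positivity)]
      congr 1; ring
    · intro q hq
      rw [hB q hq]; exact ENNReal.ofReal_lt_top
  have hle : fA ≤ᵐ[V] fB := by
    apply ae_le_of_forall_setLIntegral_le_of_sigmaFinite hfAm
    intro s hs _
    rw [← withDensity_apply _ hs, ← withDensity_apply _ hs, heq]
    simp
  -- pass to everywhere
  intro t ht
  by_contra hcon
  push Not at hcon
  have hc1 : ContinuousOn (fun t => t * p x t) (Ioi 0) := continuousOn_id.mul (hp_cont x hx)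
  have hc2 : ContinuousOn (fun t : ℝ => α / Real.Gamma (1 - α) * x * t ^ (-α)) (Ioi 0) := by
    apply ContinuousOn.mul continuousOn_const
    exact continuousOn_id.rpow_const (fun y hy => Or.inl (ne_of_gt hy))
  have hev : ∀ᶠ s in nhds t, 0 < s ∧ α / Real.Gamma (1 - α) * x * s ^ (-α) < s * p x s := by
    have hn : Ioi (0:ℝ) ∈ nhds t := Ioi_mem_nhds ht
    filter_upwards [hn, (hc2.continuousAt hn).eventually_lt (hc1.continuousAt hn) hcon]
      with s h1 h2 using ⟨h1, h2⟩
  rw [hV, Filter.EventuallyLE, ae_restrict_iff' measurableSet_Ioi] at hle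
  have := (Measure.measure_pos_of_mem_nhds (volume : Measure ℝ) hev)
  apply this.ne'
  apply measure_mono_null _ hle
  intro s hs hs'
  have h := hs' hs.1
  rw [hfA, hfB] at h
  simp only [] at h
  rw [ENNReal.ofReal_le_ofReal_iff] at h
  · exact absurd hs.2 (not_lt.2 h)
  · have := hs.1
    positivity

lemma int_G (α x q : ℝ) (hα : 0 < α) (hx : 0 < x) (hq : 0 < q) :
    ∫⁻ s in Ioc 0 q, ENNReal.ofReal (α * x * s ^ (α - 1) * (1 - Real.exp (-x * s ^ α))) =
      ENNReal.ofReal (Real.exp (-(q ^ α) * x) - 1 + q ^ α * x) := by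
  set g : ℝ → ℝ := fun s => Real.exp (-x * s ^ α) - 1 + x * s ^ α with hg
  have hcont : ContinuousOn g (Icc 0 q) := by
    have : Continuous (fun s : ℝ => s ^ α) := Real.continuous_rpow_const hα.le
    apply Continuous.continuousOn
    fun_prop
  have hderiv : ∀ s ∈ Ioo 0 q,
      HasDerivAt g (α * x * s ^ (α - 1) * (1 - Real.exp (-x * s ^ α))) s := by
    intro s hs
    have h2 := (hasDerivAt_id s).rpow_const (p := α) (Or.inl (by simpa using hs.1.ne'))
    have h3 := ((h2.const_mul (-x)).exp.sub_const 1).add (h2.const_mul x)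
    have e : α * x * s ^ (α - 1) * (1 - Real.exp (-x * s ^ α)) =
        Real.exp (-x * s ^ α) * (-x * (1 * α * s ^ (α - 1))) + x * (1 * α * s ^ (α - 1)) := by ring
    rw [e]; exact h3
  have hnn : ∀ s, 0 < s → 0 ≤ α * x * s ^ (α - 1) * (1 - Real.exp (-x * s ^ α)) := by
    intro s hs
    have he : 0 ≤ 1 - Real.exp (-x * s ^ α) := by
      have : Real.exp (-x * s ^ α) ≤ 1 := by
        rw [Real.exp_le_one_iff]
        have : 0 < x * s ^ α := by positivity
        linarith
      linarith
    positivity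
  have hint := intervalIntegral.integrableOn_deriv_of_nonneg hcont hderiv
    (fun s hs => hnn s hs.1)
  have hI := intervalIntegral.integral_eq_sub_of_hasDerivAt_of_le hq.le hcont hderiv
    ((intervalIntegrable_iff_integrableOn_Ioc_of_le hq.le).2 hint)
  rw [intervalIntegral.integral_of_le hq.le] at hI
  rw [← ofReal_integral_eq_lintegral_ofReal hint, hI]
  · congr 1
    simp only [hg, Real.zero_rpow hα.ne']
    simp; ring_nf
  · filter_upwards [ae_restrict_mem measurableSet_Ioc] with s hs using hnn s hs.1

lemma per_x (α x : ℝ) (hα : α ∈ Set.Ioc (0:ℝ) (1/2)) (hx : 0 < x) (p : ℝ → ℝ → ℝ)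
    (hp_meas : Measurable (Function.uncurry p))
    (hp_cont : ∀ x > (0:ℝ), ContinuousOn (p x) (Ioi 0))
    (hp_nonneg : ∀ x > (0:ℝ), ∀ t > (0:ℝ), 0 ≤ p x t)
    (hp_lap : ∀ x > (0:ℝ), ∀ q > (0:ℝ),
      (∫ t in Ioi (0:ℝ), Real.exp (-q * t) * p x t) = Real.exp (-x * q ^ α)) :
    (∀ t > 0, 0 ≤ α / Real.Gamma (1 - α) * x * t ^ (-(1 + α)) - p x t) ∧
    ∀ q > 0, ∫⁻ t in Ioi (0:ℝ), ENNReal.ofReal ((1 - Real.exp (-q * t)) *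
      (α / Real.Gamma (1 - α) * x * t ^ (-(1 + α)) - p x t)) =
      ENNReal.ofReal (Real.exp (-(q ^ α) * x) - 1 + q ^ α * x) := by
  have hb := p_bound α x hα hx p hp_meas hp_cont hp_nonneg hp_lap
  have hpx : Measurable (p x) := hp_meas.of_uncurry_left
  have ht1 : ∀ t : ℝ, 0 < t → t * t ^ (-(1 + α)) = t ^ (-α) := by
    intro t ht
    nth_rewrite 1 [← Real.rpow_one t]
    rw [← Real.rpow_add ht]; congr 1; ring
  have hG : 0 < Real.Gamma (1 - α) := Real.Gamma_pos_of_pos (by linarith [hα.2])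
  have hα0 := hα.1
  set h : ℝ → ℝ := fun t => α / Real.Gamma (1 - α) * x * t ^ (-(1 + α)) - p x t with hh
  have hhm : Measurable h := by fun_prop
  have hth : ∀ t, 0 < t → t * h t = α / Real.Gamma (1 - α) * x * t ^ (-α) - t * p x t := by
    intro t ht
    rw [← ht1 t ht]; simp only [hh]; ring
  have hh0 : ∀ t > 0, 0 ≤ h t := by
    intro t ht
    have h1 := hb t ht
    have h2 := hth t ht
    have : 0 ≤ t * h t := by linarith
    exact nonneg_of_mul_nonneg_right this ht
  refine ⟨hh0, fun q hq => ?_⟩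
  have hL : ∀ s > 0, ∫⁻ t in Ioi (0:ℝ), ENNReal.ofReal (t * h t) *
      ENNReal.ofReal (Real.exp (-s * t)) =
      ENNReal.ofReal (α * x * s ^ (α - 1) * (1 - Real.exp (-x * s ^ α))) := by
    intro s hs
    have hA := lapl_tp α x hα0 hx (p x) hpx (hp_nonneg x hx) (hp_lap x hx) s hs
    have hB := lapl_B α x s hα hx hs
    have he : 0 ≤ 1 - Real.exp (-x * s ^ α) := by
      have : Real.exp (-x * s ^ α) ≤ 1 := by
        rw [Real.exp_le_one_iff]
        have : 0 < x * s ^ α := by positivity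
        linarith
      linarith
    have hsum : ∫⁻ t in Ioi (0:ℝ), ENNReal.ofReal (t * h t) * ENNReal.ofReal (Real.exp (-s * t)) +
        ENNReal.ofReal (t * p x t) * ENNReal.ofReal (Real.exp (-s * t)) =
        ENNReal.ofReal (α * x * s ^ (α - 1)) := by
      rw [← hB]
      apply setLIntegral_congr_fun measurableSet_Ioi
      intro t ht
      have ht' : (0:ℝ) < t := ht
      have h1 := hh0 t ht
      have h2 := hp_nonneg x hx t ht
      simp only []
      rw [← add_mul, ← ENNReal.ofReal_add (by positivity) (by positivity), hth t ht]
      congr 2; ring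
    rw [lintegral_add_left (by fun_prop), hA] at hsum
    have h3 : ENNReal.ofReal (α * x * s ^ (α - 1)) =
        ENNReal.ofReal (α * x * s ^ (α - 1) * (1 - Real.exp (-x * s ^ α))) +
        ENNReal.ofReal (α * x * s ^ (α - 1) * Real.exp (-x * s ^ α)) := by
      rw [← ENNReal.ofReal_add (by positivity) (by positivity)]
      congr 1; ring
    rw [h3] at hsum
    exact (ENNReal.add_left_inj ENNReal.ofReal_ne_top).1 hsum
  rw [← int_G α x q hα0 hx hq]
  have e1 : ∫⁻ s in Ioc 0 q, ENNReal.ofReal (α * x * s ^ (α - 1) * (1 - Real.exp (-x * s ^ α))) =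
      ∫⁻ s in Ioc 0 q, ∫⁻ t in Ioi (0:ℝ), ENNReal.ofReal (t * h t) *
      ENNReal.ofReal (Real.exp (-s * t)) :=
    setLIntegral_congr_fun measurableSet_Ioc (fun s hs => (hL s hs.1).symm)
  rw [e1, lintegral_lintegral_swap (by simp only [Function.uncurry_def]; fun_prop)]
  apply setLIntegral_congr_fun measurableSet_Ioi
  intro t ht
  have ht' : (0:ℝ) < t := ht
  have h1 := hh0 t ht
  simp only []
  rw [lintegral_const_mul _ (by fun_prop), lint_exp_Ioc t q ht'.ne' hq.le,
    ← ENNReal.ofReal_mul (by positivity)]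
  congr 1
  change (1 - Real.exp (-q * t)) * h t = _
  field_simp

lemma psi_bd (k x : ℝ) (hk : 0 < k) (hx : 0 < x) : 0 ≤ Real.exp (-k * x) - 1 + k * x ∧
    Real.exp (-k * x) - 1 + k * x ≤ (k + k ^ 2) * min x (x ^ 2) := by
  have h0 : 0 < k * x := by positivity
  have h1 := Real.add_one_le_exp (-k * x)
  refine ⟨by linarith, ?_⟩
  have h2 : Real.exp (-k * x) ≤ 1 := by
    rw [Real.exp_le_one_iff]; linarith
  have h3 : Real.exp (-k * x) - 1 + k * x ≤ (k * x) ^ 2 := by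
    rcases le_total (k * x) 1 with h | h
    · have := Real.abs_exp_sub_one_sub_id_le (x := -k * x) (by
        rw [abs_le]; constructor <;> linarith)
      have h5 := le_abs_self (Real.exp (-k * x) - 1 - (-k * x))
      nlinarith
    · nlinarith
  rcases min_cases x (x ^ 2) with ⟨h, _⟩ | ⟨h, _⟩ <;> rw [h]
  · have : 0 < k ^ 2 * x := by positivity
    linarith
  · have : 0 < k * x ^ 2 := by positivity
    nlinarith

/-- For `α ∈ (0,1/2]`, a measure `Pi` on `(0,∞)` with
`∫ min(x,x²) Pi(dx) < ∞`, and the stable densities `p(x,·)` of index `α`, the function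
`ν(t) = ∫ ((α/Γ(1-α)) x t^(-(1+α)) - p(x,t)) Pi(dx)` is nonnegative and satisfies
`∫₀^∞ (1-e^(-qt)) ν(t) dt = ∫ (e^(-q^α x) - 1 + q^α x) Pi(dx) < ∞` for each `q > 0`;
i.e. `ν` is the Lévy measure density of the Bernstein function `q ↦ Ψ_{0,0,Pi}(q^α)`. -/
theorem levy_density_of_composed_mechanism
    (α : ℝ) (hα : α ∈ Set.Ioc (0:ℝ) (1/2))
    (Pi : Measure ℝ) (hPi0 : Pi (Iic 0) = 0)
    (hPi : (∫⁻ x, ENNReal.ofReal (min x (x ^ 2)) ∂Pi) < ⊤)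
    (p : ℝ → ℝ → ℝ)
    (hp_meas : Measurable (Function.uncurry p))
    (hp_cont : ∀ x > (0:ℝ), ContinuousOn (p x) (Ioi 0))
    (hp_nonneg : ∀ x > (0:ℝ), ∀ t > (0:ℝ), 0 ≤ p x t)
    (hp_lap : ∀ x > (0:ℝ), ∀ q > (0:ℝ),
      (∫ t in Ioi (0:ℝ), Real.exp (-q * t) * p x t) = Real.exp (-x * q ^ α))
    (ν : ℝ → ℝ)
    (hν : ∀ t > (0:ℝ),
      ν t = ∫ x, (α / Real.Gamma (1 - α) * x * t ^ (-(1 + α)) - p x t) ∂Pi) :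
    (∀ t > (0:ℝ), 0 ≤ ν t) ∧
    ∀ q > (0:ℝ),
      IntegrableOn (fun t => (1 - Real.exp (-q * t)) * ν t) (Ioi 0) ∧
      Integrable (fun x => Real.exp (-(q ^ α) * x) - 1 + q ^ α * x) Pi ∧
      (∫ t in Ioi (0:ℝ), (1 - Real.exp (-q * t)) * ν t) =
        ∫ x, (Real.exp (-(q ^ α) * x) - 1 + q ^ α * x) ∂Pi := by
  have hpos : ∀ᵐ x ∂Pi, 0 < x := by
    rw [ae_iff]
    convert hPi0 using 2
    ext x; simp
  have hPx := fun x (hx : 0 < x) => per_x α x hα hx p hp_meas hp_cont hp_nonneg hp_lap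
  have hSF : SFinite Pi := by
    set w : ℝ → ENNReal := fun x => ENNReal.ofReal (min x (x ^ 2)) with hw
    have hwm : Measurable w := by fun_prop
    have hfin : IsFiniteMeasure (Pi.withDensity w) := isFiniteMeasure_withDensity hPi.ne
    have := withDensity_inv_same (μ := Pi) hwm
      (by filter_upwards [hpos] with x hx
          simp only [hw, ne_eq, ENNReal.ofReal_eq_zero, not_le]
          exact lt_min hx (by positivity))
      (by filter_upwards with x; simp [hw])
    rw [← this]
    infer_instance
  refine ⟨fun t ht => ?_, fun q hq => ?_⟩
  · rw [hν t ht]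
    apply integral_nonneg_of_ae
    filter_upwards [hpos] with x hx using (hPx x hx).1 t ht
  have hk : 0 < q ^ α := by positivity
  have hψ : Integrable (fun x => Real.exp (-(q ^ α) * x) - 1 + q ^ α * x) Pi := by
    have hmin : Integrable (fun x : ℝ => min x (x ^ 2)) Pi := by
      refine ⟨by fun_prop, ?_⟩
      rw [hasFiniteIntegral_iff_ofReal]
      · exact hPi
      · filter_upwards [hpos] with x hx
        exact le_min hx.le (by positivity)
    apply (hmin.const_mul (q ^ α + (q ^ α) ^ 2)).mono' (by fun_prop)
    filter_upwards [hpos] with x hx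
    have := psi_bd (q ^ α) x hk hx
    rw [Real.norm_eq_abs, abs_of_nonneg this.1]
    exact this.2
  set G : ℝ × ℝ → ℝ := fun z => (1 - Real.exp (-q * z.1)) *
    (α / Real.Gamma (1 - α) * z.2 * z.1 ^ (-(1 + α)) - p z.2 z.1) with hGd
  have hGm : Measurable G := by
    have : Measurable (fun z : ℝ × ℝ => p z.2 z.1) := hp_meas.comp measurable_swap
    fun_prop
  have hG0 : ∀ x > 0, ∀ t > 0, 0 ≤ G (t, x) := by
    intro x hx t ht
    apply mul_nonneg _ ((hPx x hx).1 t ht)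
    have : Real.exp (-q * t) ≤ 1 := by
      rw [Real.exp_le_one_iff]
      nlinarith
    linarith
  have hG0' : ∀ x > 0, 0 ≤ᵐ[volume.restrict (Ioi (0:ℝ))] fun t => G (t, x) := by
    intro x hx
    filter_upwards [ae_restrict_mem measurableSet_Ioi] with t ht using hG0 x hx t ht
  have hGi : ∀ x > 0, IntegrableOn (fun t => G (t, x)) (Ioi 0) := by
    intro x hx
    refine ⟨(hGm.comp measurable_prodMk_right).aestronglyMeasurable, ?_⟩
    rw [hasFiniteIntegral_iff_ofReal (hG0' x hx)]
    simp only [hGd]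
    rw [(hPx x hx).2 q hq]
    exact ENNReal.ofReal_lt_top
  have hGv : ∀ x > 0, ∫ t in Ioi (0:ℝ), G (t, x) =
      Real.exp (-(q ^ α) * x) - 1 + q ^ α * x := by
    intro x hx
    rw [integral_eq_lintegral_of_nonneg_ae (hG0' x hx)
      (hGm.comp measurable_prodMk_right).aestronglyMeasurable]
    simp only [hGd]
    rw [(hPx x hx).2 q hq]
    exact ENNReal.toReal_ofReal (psi_bd _ _ hk hx).1
  have hGprod : Integrable G ((volume.restrict (Ioi (0:ℝ))).prod Pi) := by
    rw [integrable_prod_iff' hGm.aestronglyMeasurable]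
    refine ⟨?_, ?_⟩
    · filter_upwards [hpos] with x hx using hGi x hx
    · apply hψ.congr
      filter_upwards [hpos] with x hx
      rw [← hGv x hx]
      apply setIntegral_congr_fun measurableSet_Ioi
      intro t ht
      simp only []
      rw [Real.norm_eq_abs, abs_of_nonneg (hG0 x hx t ht)]
  have hin : ∀ t ∈ Ioi (0:ℝ), ∫ x, G (t, x) ∂Pi = (1 - Real.exp (-q * t)) * ν t := by
    intro t ht
    simp only [hGd]
    rw [integral_const_mul, hν t ht]
  refine ⟨?_, hψ, ?_⟩
  · exact (integrableOn_congr_fun hin measurableSet_Ioi).1 hGprod.integral_prod_left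
  · rw [← setIntegral_congr_fun measurableSet_Ioi hin,
      integral_integral_swap (f := fun t x => G (t, x)) hGprod]
    apply integral_congr_ae
    filter_upwards [hpos] with x hx using hGv x hx
end
end

section
/- Let f belong to the class B₁, i.e. f(q) = c + ∫_{(0,∞)} e^{−qx} μ(dx) for q > 0, where c ≥ 0 and μ is a measure on (0,∞) with ∫_{(0,∞)} min(1, 1/x) μ(dx) < ∞, and let g be a Bernstein function with g(q) > 0 for all q > 0. Then f ∘ g belongs to B₁: there exist c' ≥ 0 and a measure μ' on (0,∞) with ∫_{(0,∞)} min(1, 1/x) μ'(dx) < ∞ such that f(g(q)) = c' + ∫_{(0,∞)} e^{−qx} μ'(dx) for all q > 0. -/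
open MeasureTheory Real Set

noncomputable section

/-! ### Alternating functions -/

/-- `AM n φ`: alternating signs of the first `n` derivatives on `(0,∞)`. -/
def AM : ℕ → (ℝ → ℝ) → Prop
  | 0, φ => ∀ q > (0:ℝ), 0 ≤ φ q
  | n + 1, φ => (∀ q > (0:ℝ), 0 ≤ φ q) ∧
      ∃ ψ : ℝ → ℝ, (∀ q > (0:ℝ), HasDerivAt φ (-ψ q) q) ∧ AM n ψ

lemma AM.nonneg {n : ℕ} {φ : ℝ → ℝ} (h : AM n φ) : ∀ q > (0:ℝ), 0 ≤ φ q := by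
  cases n with
  | zero => exact h
  | succ n => exact h.1

lemma AM.pred {n : ℕ} {φ : ℝ → ℝ} (h : AM (n+1) φ) : AM n φ := by
  induction n generalizing φ with
  | zero => exact h.1
  | succ n ih =>
    obtain ⟨h1, ψ, h2, h3⟩ := h
    exact ⟨h1, ψ, h2, ih h3⟩

lemma AM.add {n : ℕ} {φ ψ : ℝ → ℝ} (h : AM n φ) (h' : AM n ψ) :
    AM n (fun q => φ q + ψ q) := by
  induction n generalizing φ ψ with
  | zero => exact fun q hq => add_nonneg (h q hq) (h' q hq)
  | succ n ih =>
    obtain ⟨h1, a, h2, h3⟩ := h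
    obtain ⟨h1', a', h2', h3'⟩ := h'
    refine ⟨fun q hq => add_nonneg (h1 q hq) (h1' q hq), fun q => a q + a' q, ?_, ih h3 h3'⟩
    intro q hq
    exact HasDerivAt.congr_deriv ((h2 q hq).add (h2' q hq)) (by ring)

lemma AM.mul {n : ℕ} {φ ψ : ℝ → ℝ} (h : AM n φ) (h' : AM n ψ) :
    AM n (fun q => φ q * ψ q) := by
  induction n generalizing φ ψ with
  | zero => exact fun q hq => mul_nonneg (h q hq) (h' q hq)
  | succ n ih =>
    have p := h.pred
    have p' := h'.pred
    obtain ⟨h1, a, h2, h3⟩ := h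
    obtain ⟨h1', a', h2', h3'⟩ := h'
    refine ⟨fun q hq => mul_nonneg (h1 q hq) (h1' q hq),
      fun q => a q * ψ q + φ q * a' q, ?_, (ih h3 p').add (ih p h3')⟩
    intro q hq
    exact HasDerivAt.congr_deriv ((h2 q hq).mul (h2' q hq)) (by ring)

lemma AM.const (n : ℕ) {a : ℝ} (ha : 0 ≤ a) : AM n (fun _ => a) := by
  induction n generalizing a with
  | zero => exact fun _ _ => ha
  | succ n ih =>
    refine ⟨fun _ _ => ha, fun _ => 0, fun q _ => ?_, ih le_rfl⟩
    simpa using hasDerivAt_const q a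

lemma AM.exp_neg {g g' : ℝ → ℝ} (hg : ∀ q > (0:ℝ), HasDerivAt g (g' q) q)
    (hg' : ∀ n, AM n g') {x : ℝ} (hx : 0 ≤ x) (n : ℕ) :
    AM n (fun q => Real.exp (-g q * x)) := by
  induction n with
  | zero => exact fun _ _ => (Real.exp_pos _).le
  | succ n ih =>
    refine ⟨fun _ _ => (Real.exp_pos _).le, fun q => (x * g' q) * Real.exp (-g q * x), ?_,
      ((AM.const n hx).mul (hg' n)).mul ih⟩
    intro q hq
    exact HasDerivAt.congr_deriv (((hg q hq).fun_neg).mul_const x).exp (by ring)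

lemma antitoneOn_of_hasDerivAt {φ ψ : ℝ → ℝ} (h2 : ∀ q > (0:ℝ), HasDerivAt φ (-ψ q) q)
    (h3 : ∀ q > (0:ℝ), 0 ≤ ψ q) : AntitoneOn φ (Ioi 0) := by
  apply antitoneOn_of_deriv_nonpos (convex_Ioi 0)
  · exact fun q hq => (h2 q hq).continuousAt.continuousWithinAt
  · intro q hq
    rw [interior_Ioi] at hq
    exact (h2 q hq).differentiableAt.differentiableWithinAt
  · intro q hq
    rw [interior_Ioi] at hq
    rw [(h2 q hq).deriv]
    linarith [h3 q hq]

/-- backward difference operator -/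
def dif (h : ℝ) (φ : ℝ → ℝ) : ℝ → ℝ := fun q => φ q - φ (q + h)

lemma AM.dif1 {n : ℕ} {φ : ℝ → ℝ} {h : ℝ} (hh : 0 < h) (H : AM (n+1) φ) : AM n (dif h φ) := by
  induction n generalizing φ with
  | zero =>
    obtain ⟨h1, a, h2, h3⟩ := H
    have := antitoneOn_of_hasDerivAt h2 h3
    intro q hq
    have := this (mem_Ioi.2 hq) (mem_Ioi.2 (by linarith : 0 < q + h)) (by linarith)
    simp only [dif]; linarith
  | succ n ih =>
    obtain ⟨h1, a, h2, h3⟩ := H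
    have := antitoneOn_of_hasDerivAt h2 h3.nonneg
    refine ⟨?_, dif h a, ?_, ih h3⟩
    · intro q hq
      have := this (mem_Ioi.2 hq) (mem_Ioi.2 (by linarith : 0 < q + h)) (by linarith)
      simp only [dif]; linarith
    · intro q hq
      have e1 := h2 q hq
      have e2 := (h2 (q+h) (by linarith)).comp_add_const q h
      exact HasDerivAt.congr_deriv (e1.sub e2) (by simp only [dif]; ring)

lemma AM.iter_dif {m n : ℕ} {φ : ℝ → ℝ} {h : ℝ} (hh : 0 < h) (H : AM (m+n) φ) :
    AM m ((dif h)^[n] φ) := by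
  induction n generalizing φ with
  | zero => exact H
  | succ n ih => exact ih (AM.dif1 hh H)

lemma IsBernstein.deriv {g : ℝ → ℝ} (hg : IsBernstein g) :
    ∃ g' : ℝ → ℝ, (∀ q > (0:ℝ), HasDerivAt g (g' q) q) ∧ ∀ n, AM n g' := by
  obtain ⟨h1, h2, h3⟩ := hg
  have hd : ∀ k : ℕ, ∀ q > (0:ℝ), HasDerivAt (iteratedDerivWithin k g (Ioi 0))
      (iteratedDerivWithin (k+1) g (Ioi 0) q) q := by
    intro k q hq
    have := (h1.differentiableOn_iteratedDerivWithin (m := k) (by exact_mod_cast ENat.natCast_lt_top k)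
      (uniqueDiffOn_Ioi 0)) q hq
    rw [iteratedDerivWithin_succ]
    exact this.hasDerivWithinAt.hasDerivAt (Ioi_mem_nhds hq)
  refine ⟨iteratedDerivWithin 1 g (Ioi 0), ?_, ?_⟩
  · intro q hq
    simpa [iteratedDerivWithin_zero] using hd 0 q hq
  · have : ∀ n k : ℕ, AM n (fun q => (-1 : ℝ) ^ k * iteratedDerivWithin (k+1) g (Ioi 0) q) := by
      intro n
      induction n with
      | zero => exact fun k q hq => by simpa using h3 (k+1) (by omega) q hq
      | succ n ih =>
        intro k
        refine ⟨fun q hq => by simpa using h3 (k+1) (by omega) q hq, _, ?_, ih (k+1)⟩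
        intro q hq
        exact HasDerivAt.congr_deriv ((hd (k+1) q hq).const_mul ((-1:ℝ)^k)) (by ring)
    intro n
    simpa using this n 0

lemma concave_bound {g g' : ℝ → ℝ} (hg : ∀ q > (0:ℝ), HasDerivAt g (g' q) q)
    (hg' : ∀ n, AM n g') (h0 : ∀ q > (0:ℝ), 0 < g q) {q : ℝ} (hq : 0 < q) (hq1 : q ≤ 1) :
    g 1 / 2 * q ≤ g q := by
  obtain ⟨-, a, ha, ha'⟩ := hg' 1
  have hanti := antitoneOn_of_hasDerivAt ha ha'
  have hc : ConcaveOn ℝ (Ioi 0) g := by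
    apply AntitoneOn.concaveOn_of_deriv (convex_Ioi 0)
    · exact fun q hq => (hg q hq).continuousAt.continuousWithinAt
    · intro q hq
      rw [interior_Ioi] at hq
      exact (hg q hq).differentiableAt.differentiableWithinAt
    · rw [interior_Ioi]
      intro x hx y hy hxy
      rw [(hg x hx).deriv, (hg y hy).deriv]
      exact hanti hx hy hxy
  have hpos : 0 < 1 - q/2 := by linarith
  set t := (q/2)/(1-q/2) with ht
  have ht0 : 0 ≤ t := by positivity
  have ht1 : t ≤ 1 := by rw [ht, div_le_one hpos]; linarith
  have htq : q / 2 ≤ t := by rw [ht, le_div_iff₀ hpos]; nlinarith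
  have := hc.2 (mem_Ioi.2 (half_pos hq)) (mem_Ioi.2 one_pos) (sub_nonneg.2 ht1) ht0 (by ring)
  have e : (1 - t) • (q/2) + t • (1:ℝ) = q := by
    have h2q : (2 - q) ≠ 0 := by linarith
    simp only [smul_eq_mul, ht]; field_simp; ring
  rw [e] at this
  simp only [smul_eq_mul] at this
  have := mul_nonneg (sub_nonneg.2 ht1) (h0 _ (half_pos hq)).le
  nlinarith [h0 1 one_pos]

/-! ### Hausdorff moment problem -/

open Filter Topology unitInterval

lemma haus_expand {b : ℕ → ℕ → ℝ} (hb : ∀ k j, b k j = b k (j+1) + b (k+1) j) (M : ℕ) :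
    ∀ k j, b k j = ∑ ij ∈ Finset.HasAntidiagonal.antidiagonal M, (M.choose ij.1 : ℝ) * b (k + ij.1) (j + ij.2) := by
  induction M with
  | zero => intro k j; simp
  | succ M ih =>
    intro k j
    rw [Finset.sum_antidiagonal_choose_succ_mul (fun i l => b (k + i) (j + l)) M, hb k j,
      ih k (j+1), ih (k+1) j]
    congr 1
    · refine Finset.sum_congr rfl fun ij _ => ?_
      rw [show j + 1 + ij.2 = j + (ij.2 + 1) by ring]
    · refine Finset.sum_congr rfl fun ij hij => ?_
      rw [Finset.HasAntidiagonal.mem_antidiagonal] at hij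
      rw [show k + 1 + ij.1 = k + (ij.1 + 1) by ring, Nat.choose_symm_of_eq_add hij.symm]

lemma haus_expand' {b : ℕ → ℕ → ℝ} (hb : ∀ k j, b k j = b k (j+1) + b (k+1) j) (n N : ℕ)
    (hN : n ≤ N) (hN0 : 0 < N) :
    b n 0 = ∑ k ∈ Finset.range (N+1), (N.choose k : ℝ) * b k (N-k) *
      ∏ i ∈ Finset.range n, ((1 - (i:ℝ)/N)⁻¹ * ((k:ℝ)/N - (i:ℝ)/N)) := by
  obtain ⟨M, rfl⟩ := Nat.exists_eq_add_of_le hN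
  have hN0' : ((n + M : ℕ) : ℝ) ≠ 0 := by positivity
  have hprod : ∀ k : ℕ, ∏ i ∈ Finset.range n, ((1 - (i:ℝ)/(n+M:ℕ))⁻¹ * ((k:ℝ)/(n+M:ℕ) - (i:ℝ)/(n+M:ℕ)))
      = (k.descFactorial n : ℝ) / ((n+M).descFactorial n : ℝ) := by
    intro k
    rw [← descPochhammer_eval_eq_descFactorial, ← descPochhammer_eval_eq_descFactorial]
    rw [descPochhammer_eval_eq_prod_range, descPochhammer_eval_eq_prod_range, ← Finset.prod_div_distrib]
    refine Finset.prod_congr rfl fun i hi => ?_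
    rw [Finset.mem_range] at hi
    have : ((n + M : ℕ) : ℝ) - i ≠ 0 := by
      have : (i:ℝ) < ((n+M : ℕ):ℝ) := by exact_mod_cast (by omega)
      linarith
    have h2 : (1 - (i:ℝ)/(n+M:ℕ)) ≠ 0 := by
      rw [show (1 - (i:ℝ)/(n+M:ℕ)) = (((n + M : ℕ) : ℝ) - i) / (n+M:ℕ) by field_simp]
      exact div_ne_zero this hN0'
    rw [show (1 - (i:ℝ)/(n+M:ℕ)) = (((n + M : ℕ) : ℝ) - i) / (n+M:ℕ) by field_simp]
    field_simp
  simp_rw [hprod]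
  rw [show n + M + 1 = n + (M + 1) by ring, Finset.sum_range_add, Finset.sum_eq_zero, zero_add,
    haus_expand hb M n 0, Finset.Nat.sum_antidiagonal_eq_sum_range_succ_mk]
  · refine Finset.sum_congr rfl fun i hi => ?_
    have e := Nat.choose_mul (n := n + M) (k := n + i) (s := n) (by omega)
    have hd : ((n+M).descFactorial n : ℝ) ≠ 0 := by
      exact_mod_cast (Nat.pos_iff_ne_zero.1 (Nat.descFactorial_pos.2 (by omega)))
    have : ((n+M).choose (n+i) : ℝ) * ((n+i).descFactorial n) = (M.choose i) * ((n+M).descFactorial n) := by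
      rw [Nat.descFactorial_eq_factorial_mul_choose, Nat.descFactorial_eq_factorial_mul_choose]
      have e' : ((n+M).choose (n+i) : ℝ) * ((n+i).choose n) = ((n+M).choose n) * (M.choose i) := by
        have := e
        simp only [Nat.add_sub_cancel_left] at this
        exact_mod_cast this
      push_cast
      linear_combination (n.factorial : ℝ) * e'
    rw [show n + M - (n + i) = M - i by omega, zero_add]
    field_simp
    linear_combination -b (n+i) (M-i) * this
  · intro k hk
    rw [Finset.mem_range] at hk
    simp [Nat.descFactorial_of_lt hk]

lemma hausdorff {b : ℕ → ℕ → ℝ} (hb : ∀ k j, b k j = b k (j+1) + b (k+1) j)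
    (hb0 : ∀ k j, 0 ≤ b k j) :
    ∃ ν : Measure I, IsFiniteMeasure ν ∧ ∀ n : ℕ, ∫ t : I, (t:ℝ)^n ∂ν = b n 0 := by
  let pt : ℕ → ℕ → I := fun N k => projIcc 0 1 zero_le_one ((k:ℝ)/N)
  let w : ℕ → ℕ → ℝ := fun N k => (N.choose k : ℝ) * b k (N-k)
  have hw : ∀ N k, 0 ≤ w N k := fun N k => mul_nonneg (by positivity) (hb0 _ _)
  let m : ℕ → Measure I := fun N => ∑ k ∈ Finset.range (N+1), ENNReal.ofReal (w N k) • Measure.dirac (pt N k)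
  have hsumI : ∀ N (f : C(I, ℝ)), ∫ t, f t ∂(m N) = ∑ k ∈ Finset.range (N+1), w N k * f (pt N k) := by
    intro N f
    rw [integral_finsetSum_measure]
    · refine Finset.sum_congr rfl fun k _ => ?_
      rw [integral_smul_measure, integral_dirac, ENNReal.toReal_ofReal (hw N k), smul_eq_mul]
    · intro k _
      exact (integrable_dirac (by simp)).smul_measure ENNReal.ofReal_ne_top
  have hsum : ∀ N, ∑ k ∈ Finset.range (N+1), w N k = b 0 0 := by
    intro N
    rw [haus_expand hb N 0 0, Finset.Nat.sum_antidiagonal_eq_sum_range_succ_mk]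
    simp [w]
  have hmass : ∀ N, m N univ = ENNReal.ofReal (b 0 0) := by
    intro N
    rw [← hsum N, ENNReal.ofReal_sum_of_nonneg (fun k _ => hw N k)]
    simp [m]
  have hfin : ∀ N, IsFiniteMeasure (m N) := fun N => ⟨by rw [hmass]; exact ENNReal.ofReal_lt_top⟩
  let fm : ℕ → FiniteMeasure I := fun N => ⟨m N, hfin N⟩
  have hcomp := isCompact_setOfPred_finiteMeasure_le_of_compactSpace I (b 0 0).toNNReal
  obtain ⟨ν, -, hν⟩ := hcomp.ultrafilter_le_nhds ((hyperfilter ℕ).map fm) (by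
    rw [Filter.le_principal_iff]
    refine Filter.mem_map.2 (Filter.univ_mem' fun N => ?_)
    simp only [mem_preimage, mem_ofPred_eq]
    apply le_of_eq
    rw [FiniteMeasure.mass]
    show (m N univ).toNNReal = _
    rw [hmass]; rfl)
  have hν' : Tendsto fm (hyperfilter ℕ) (𝓝 ν) := hν
  refine ⟨ν, inferInstance, fun n => ?_⟩
  let X : C(I, ℝ) := ⟨fun t => (t:ℝ), by fun_prop⟩
  let p : ℕ → C(I, ℝ) := fun N => ∏ i ∈ Finset.range n,
    ((1 - (i:ℝ)/N)⁻¹ • (X - algebraMap ℝ C(I,ℝ) ((i:ℝ)/N)))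
  have hp : Tendsto p atTop (𝓝 (X^n)) := by
    have : X ^ n = ∏ i ∈ Finset.range n, X := by simp
    rw [this]
    refine tendsto_finsetProd _ fun i _ => ?_
    have h0 : Tendsto (fun N : ℕ => (i:ℝ)/N) atTop (𝓝 0) := tendsto_const_div_atTop_nhds_zero_nat _
    have h1 : Tendsto (fun N : ℕ => (1 - (i:ℝ)/N)⁻¹) atTop (𝓝 1) := by
      have := (h0.const_sub 1).inv₀ (by norm_num)
      simpa using this
    have h2 : Tendsto (fun N : ℕ => X - algebraMap ℝ C(I,ℝ) ((i:ℝ)/N)) atTop (𝓝 (X - algebraMap ℝ C(I,ℝ) 0)) :=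
      (((continuous_algebraMap ℝ C(I,ℝ)).tendsto 0).comp h0).const_sub X
    simpa using h1.smul h2
  have hpint : ∀ N, n ≤ N → 0 < N → ∫ t, p N t ∂(m N) = b n 0 := by
    intro N h1 h2
    rw [hsumI, haus_expand' hb n N h1 h2]
    refine Finset.sum_congr rfl fun k hk => ?_
    have hk' : k ≤ N := by simpa [Nat.lt_succ_iff] using hk
    have : ((pt N k : I) : ℝ) = (k:ℝ)/N := by
      have : (k:ℝ)/N ∈ Icc (0:ℝ) 1 := ⟨by positivity, by
        rw [div_le_one (by positivity)]; exact_mod_cast hk'⟩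
      simp only [pt, projIcc_of_mem zero_le_one this]
    simp only [p, w, ContinuousMap.coe_prod, Finset.prod_apply]
    congr 1
    refine Finset.prod_congr rfl fun i _ => ?_
    simp [X, this]
  have hlim : Tendsto (fun N => ∫ t, (X^n) t ∂(m N)) atTop (𝓝 (b n 0)) := by
    rw [tendsto_iff_dist_tendsto_zero]
    have h3 : Tendsto (fun N => dist (X^n) (p N) * b 0 0) atTop (𝓝 0) := by
      have := (tendsto_iff_dist_tendsto_zero.1 hp).mul_const (b 0 0)
      simpa [dist_comm] using this
    refine squeeze_zero' (Eventually.of_forall fun _ => dist_nonneg) ?_ h3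
    filter_upwards [eventually_ge_atTop n, eventually_gt_atTop 0] with N h1 h2
    rw [← hpint N h1 h2, hsumI, hsumI, Real.dist_eq, ← Finset.sum_sub_distrib, ← hsum N, Finset.mul_sum]
    refine (Finset.abs_sum_le_sum_abs _ _).trans (Finset.sum_le_sum fun k _ => ?_)
    rw [← mul_sub, abs_mul, abs_of_nonneg (hw N k), mul_comm]
    refine mul_le_mul_of_nonneg_right ?_ (hw N k)
    rw [← Real.dist_eq]
    exact ContinuousMap.dist_apply_le_dist _
  have hlim2 := (FiniteMeasure.tendsto_iff_forall_integral_tendsto.1 hν')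
    (BoundedContinuousFunction.mkOfCompact (X^n))
  have := tendsto_nhds_unique hlim2 (hlim.mono_left Nat.hyperfilter_le_atTop)
  simpa [X] using this

lemma integrable_I (P : Measure I) [IsFiniteMeasure P] {f : I → ℝ} (hf : Continuous f) :
    Integrable f P :=
  hf.integrable_of_hasCompactSupport (HasCompactSupport.of_compactSpace _)

lemma continuous_integral_I (P : Measure I) [IsFiniteMeasure P] :
    Continuous (fun f : C(I, ℝ) => ∫ t, f t ∂P) := by
  have : LipschitzWith (P.real univ).toNNReal (fun f : C(I, ℝ) => ∫ t, f t ∂P) := by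
    apply LipschitzWith.of_dist_le_mul
    intro f g
    rw [Real.coe_toNNReal _ measureReal_nonneg, dist_eq_norm,
      ← integral_sub (integrable_I P f.continuous) (integrable_I P g.continuous), mul_comm]
    apply norm_integral_le_of_norm_le_const
    exact Eventually.of_forall fun t => by
      rw [← dist_eq_norm]; exact ContinuousMap.dist_apply_le_dist _
  exact this.continuous

/-- finite measures on the unit interval are determined by moments -/
lemma moments_unique {P Q : Measure I} [IsFiniteMeasure P] [IsFiniteMeasure Q]
    (h : ∀ n : ℕ, ∫ t : I, (t:ℝ)^n ∂P = ∫ t : I, (t:ℝ)^n ∂Q) : P = Q := by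
  have key : ∀ f : C(I, ℝ), ∫ t, f t ∂P = ∫ t, f t ∂Q := by
    intro f
    have hcl : IsClosed {f : C(I, ℝ) | ∫ t, f t ∂P = ∫ t, f t ∂Q} :=
      isClosed_eq (continuous_integral_I P) (continuous_integral_I Q)
    have hsub : ((polynomialFunctions I : Subalgebra ℝ C(I,ℝ)) : Set C(I,ℝ)) ⊆
        {f : C(I, ℝ) | ∫ t, f t ∂P = ∫ t, f t ∂Q} := by
      rintro _ ⟨p, -, rfl⟩
      simp only [mem_ofPred_eq]
      have e : ∀ (κ : Measure I) [IsFiniteMeasure κ], ∫ t : I, (p.eval (t:ℝ)) ∂κ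
          = ∑ i ∈ Finset.range (p.natDegree + 1), p.coeff i * ∫ t : I, (t:ℝ)^i ∂κ := by
        intro κ _
        simp_rw [Polynomial.eval_eq_sum_range]
        rw [integral_finsetSum]
        · simp_rw [integral_const_mul]
        · intro i _
          exact integrable_I κ (by fun_prop)
      have := e P
      have := e Q
      simp_all
    have : f ∈ (polynomialFunctions I).topologicalClosure := by
      rw [polynomialFunctions_closure_eq_top']; trivial
    exact closure_minimal hsub hcl this
  apply ext_of_forall_integral_eq_of_IsFiniteMeasure
  intro f
  exact key f.toContinuousMap

/-! ### Bernstein's theorem -/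

/-- complete monotonicity through finite differences -/
def DCM (F : ℝ → ℝ) : Prop :=
  ∀ h > (0:ℝ), ∀ n : ℕ, ∀ q > (0:ℝ), 0 ≤ (dif h)^[n] F q

lemma DCM.step {F : ℝ → ℝ} (hF : DCM F) {q₀ h : ℝ} (hq : 0 < q₀) (hh : 0 < h) :
    ∃ ν : Measure I, IsFiniteMeasure ν ∧ ∀ n : ℕ, ∫ t : I, (t:ℝ)^n ∂ν = F (q₀ + n * h) := by
  obtain ⟨ν, h1, h2⟩ := hausdorff (b := fun k j => (dif h)^[j] F (q₀ + k * h)) (by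
    intro k j
    simp only [Function.iterate_succ_apply', dif]
    rw [show q₀ + ((k+1:ℕ):ℝ) * h = q₀ + k * h + h by push_cast; ring]
    ring) (fun k j => hF h hh j _ (by positivity))
  exact ⟨ν, h1, fun n => by simpa using h2 n⟩

lemma DCM.onI {F : ℝ → ℝ} (hF : DCM F) (hc : ContinuousOn F (Ioi 0)) {q₀ : ℝ} (hq : 0 < q₀) :
    ∃ ν : Measure I, IsFiniteMeasure ν ∧ ∀ q ≥ (0:ℝ), ∫ t : I, (t:ℝ)^q ∂ν = F (q₀ + q) := by
  obtain ⟨ν, hν, hm⟩ := hF.step hq one_pos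
  refine ⟨ν, hν, ?_⟩
  have hrat : ∀ n m : ℕ, 0 < m → ∫ t : I, (t:ℝ)^((n:ℝ)/m) ∂ν = F (q₀ + (n:ℝ)/m) := by
    intro n m hm0
    have hm0' : (m:ℝ) ≠ 0 := by positivity
    obtain ⟨κ, hκ, hmκ⟩ := hF.step hq (h := 1/(m:ℝ)) (by positivity)
    let φ : I → I := fun t => t ^ m
    have hφ : Measurable φ := by
      have : Continuous φ := by fun_prop
      exact this.measurable
    have : ν = κ.map φ := by
      apply moments_unique
      intro i
      rw [integral_map hφ.aemeasurable (by
        exact (by fun_prop : Continuous fun t : I => (t:ℝ)^i).aestronglyMeasurable), hm i]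
      have := hmκ (m * i)
      have e3 : ∀ t : I, ((φ t : I) : ℝ)^i = (t:ℝ)^(m*i) := fun t => by
        rw [pow_mul]; rfl
      simp_rw [e3]
      rw [this]
      congr 1
      push_cast
      field_simp
    rw [this, integral_map hφ.aemeasurable (by
        exact (Continuous.rpow_const (by fun_prop) (fun _ => Or.inr (by positivity)) : Continuous fun t : I => (t:ℝ)^((n:ℝ)/m)).aestronglyMeasurable)]
    have := hmκ n
    rw [show q₀ + (n:ℝ)/m = q₀ + n * (1/m) by ring, ← this]
    refine integral_congr_ae (Eventually.of_forall fun t => ?_)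
    show ((t:ℝ)^m)^((n:ℝ)/m) = (t:ℝ)^n
    rw [← Real.rpow_natCast, ← Real.rpow_mul t.2.1, mul_div_cancel₀ _ hm0', Real.rpow_natCast]
  intro q hq0
  rcases hq0.eq_or_lt with rfl | hq0
  · simpa using hrat 0 1 one_pos
  -- both sides are continuous on `(0, ∞)`
  have c1 : ContinuousOn (fun q : ℝ => ∫ t : I, (t:ℝ)^q ∂ν) (Ioi 0) := by
    intro q hq
    apply ContinuousAt.continuousWithinAt
    apply continuousAt_of_dominated (bound := fun _ => 1)
    · filter_upwards [Ioi_mem_nhds hq] with r hr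
      exact (Continuous.rpow_const (by fun_prop) (fun _ => Or.inr (le_of_lt hr)) : Continuous fun t : I => (t:ℝ)^r).aestronglyMeasurable
    · filter_upwards [Ioi_mem_nhds hq] with r hr
      refine Eventually.of_forall fun t => ?_
      rw [Real.norm_of_nonneg (Real.rpow_nonneg t.2.1 _)]
      exact Real.rpow_le_one t.2.1 t.2.2 (le_of_lt hr)
    · exact integrable_const _
    · refine Eventually.of_forall fun t => ?_
      exact Real.continuousAt_const_rpow' (ne_of_gt hq)
  have c2 : ContinuousOn (fun q : ℝ => F (q₀ + q)) (Ioi 0) := by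
    refine hc.comp (by fun_prop) fun q hq => ?_
    simp only [mem_Ioi] at *; linarith
  have heq : EqOn (fun q : ℝ => ∫ t : I, (t:ℝ)^q ∂ν) (fun q : ℝ => F (q₀ + q))
      (Ioi 0 ∩ range ((↑) : ℚ → ℝ)) := by
    rintro _ ⟨hx, x, rfl⟩
    have hx0 : 0 < x := by exact_mod_cast (mem_Ioi.1 hx)
    have e : (x:ℝ) = (x.num.toNat : ℝ) / (x.den : ℝ) := by
      have h1 : ((x.num.toNat : ℤ) : ℝ) = x.num := by
        rw [Int.toNat_of_nonneg (Rat.num_nonneg.2 hx0.le)]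
      have h2 := Rat.cast_def (K := ℝ) x
      rw [h2, ← h1, Int.cast_natCast]
    simp only [e]
    exact hrat _ _ x.den_pos
  exact heq.of_subset_closure c1 c2 inter_subset_left
    (fun y hy => Rat.denseRange_cast.open_subset_closure_inter isOpen_Ioi hy) hq0

/-- a version of Bernstein's theorem on the unit interval -/
lemma DCM.bernstein_I {F : ℝ → ℝ} (hF : DCM F) (hc : ContinuousOn F (Ioi 0)) :
    ∃ ν : Measure I, IsFiniteMeasure ν ∧ (∀ᵐ t : I ∂ν, 0 < (t:ℝ)) ∧
      ∀ q > (0:ℝ), ∫⁻ t : I, ENNReal.ofReal ((t:ℝ)^(q-1)) ∂ν = ENNReal.ofReal (F q) := by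
  obtain ⟨ν, hν, h1⟩ := hF.onI hc one_pos
  have key : ∀ p > (0:ℝ), p < 1 → ∃ κ : Measure I, IsFiniteMeasure κ ∧
      (∀ q ≥ (0:ℝ), ∫ t : I, (t:ℝ)^q ∂κ = F (p + q)) ∧
      ν = κ.withDensity (fun t => ENNReal.ofReal ((t:ℝ)^(1-p))) := by
    intro p hp hp1
    obtain ⟨κ, hκ, h2⟩ := hF.onI hc hp
    have hpc : Continuous fun t : I => (t:ℝ)^(1-p) :=
      Continuous.rpow_const (by fun_prop) (fun _ => Or.inr (by linarith))
    have : IsFiniteMeasure (κ.withDensity (fun t => ENNReal.ofReal ((t:ℝ)^(1-p)))) :=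
      isFiniteMeasure_withDensity_ofReal (integrable_I κ hpc).2
    refine ⟨κ, hκ, h2, ?_⟩
    apply moments_unique
    intro n
    rw [integral_withDensity_eq_integral_toReal_smul (by fun_prop)
      (Eventually.of_forall fun _ => ENNReal.ofReal_lt_top)]
    have e1 := h1 n (by positivity)
    have e2 := h2 (n + (1 - p)) (by have : (0:ℝ) ≤ n := by positivity
                                    linarith)
    rw [show p + (n + (1-p)) = 1 + n by ring, ← e1] at e2
    simp_rw [Real.rpow_natCast] at e2
    rw [← e2]
    refine integral_congr_ae (Eventually.of_forall fun t => ?_)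
    simp only [smul_eq_mul]
    rw [ENNReal.toReal_ofReal (Real.rpow_nonneg t.2.1 _)]
    rw [Real.rpow_add_of_nonneg t.2.1 (by positivity) (by linarith), Real.rpow_natCast]
    ring
  refine ⟨ν, hν, ?_, ?_⟩
  · obtain ⟨κ, -, -, e⟩ := key (1/2) (by norm_num) (by norm_num)
    rw [e, ae_withDensity_iff (by fun_prop)]
    refine Eventually.of_forall fun t ht => ?_
    rcases t.2.1.eq_or_lt with h | h
    · rw [← h] at ht
      norm_num at ht
    · exact h
  · intro q hq
    set p := min q 1 / 2 with hp
    have hp0 : 0 < p := by positivity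
    have hp1 : p < 1 := by have := min_le_right q 1; linarith
    have hpq : p < q := by have := min_le_left q 1; linarith
    obtain ⟨κ, hκ, h2, e⟩ := key p hp0 hp1
    have e2 := h2 (q - p) (by linarith)
    rw [show p + (q - p) = q by ring] at e2
    have hpc : Continuous fun t : I => (t:ℝ)^(q-p) :=
      Continuous.rpow_const (by fun_prop) (fun _ => Or.inr (by linarith))
    rw [← e2, ofReal_integral_eq_lintegral_ofReal (integrable_I κ hpc)
      (Eventually.of_forall fun t => Real.rpow_nonneg t.2.1 _), e,
      lintegral_withDensity_eq_lintegral_mul _ (by fun_prop) (by fun_prop)]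
    refine lintegral_congr fun t => ?_
    simp only [Pi.mul_apply]
    rw [← ENNReal.ofReal_mul (Real.rpow_nonneg t.2.1 _)]
    congr 1
    rcases t.2.1.eq_or_lt with h | h
    · rw [← h, Real.zero_rpow (x := 1 - p) (by linarith), Real.zero_rpow (x := q - p) (by linarith), zero_mul]
    · rw [← Real.rpow_add h]; congr 1; ring

/-- Bernstein's theorem on `[0,∞)` -/
lemma DCM.bernstein {F : ℝ → ℝ} (hF : DCM F) (hc : ContinuousOn F (Ioi 0)) :
    ∃ ρ : Measure ℝ, SFinite ρ ∧ ρ (Iio 0) = 0 ∧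
      ∀ q > (0:ℝ), ∫⁻ x, ENNReal.ofReal (Real.exp (-q * x)) ∂ρ = ENNReal.ofReal (F q) := by
  obtain ⟨ν, hν, hpos, h⟩ := hF.bernstein_I hc
  have hm : Measurable (fun t : I => -Real.log (t:ℝ)) := by fun_prop
  refine ⟨(ν.withDensity (fun t => ENNReal.ofReal ((t:ℝ)⁻¹))).map (fun t : I => -Real.log (t:ℝ)),
    inferInstance, ?_, ?_⟩
  · rw [Measure.map_apply hm measurableSet_Iio]
    have e : (fun t : I => -Real.log (t:ℝ)) ⁻¹' (Iio 0) = ∅ := by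
      ext t
      simpa using Real.log_nonpos t.2.1 t.2.2
    rw [e, measure_empty]
  · intro q hq
    rw [lintegral_map (by fun_prop) hm, lintegral_withDensity_eq_lintegral_mul _ (by fun_prop)
      (by fun_prop), ← h q hq]
    refine lintegral_congr_ae ?_
    filter_upwards [hpos] with t ht
    simp only [Pi.mul_apply]
    rw [← ENNReal.ofReal_mul (by positivity)]
    congr 1
    rw [Real.rpow_sub ht, Real.rpow_one, Real.rpow_def_of_pos ht]
    rw [show -q * -Real.log t = Real.log t * q by ring]
    ring

/-! ### The main theorem -/

lemma exp_neg_le_min {a x : ℝ} (ha : 0 < a) (hx : 0 < x) :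
    Real.exp (-a * x) ≤ max 1 a⁻¹ * min 1 x⁻¹ := by
  have hax : 0 < a * x := by positivity
  have h1 : Real.exp (-a * x) ≤ 1 := Real.exp_le_one_iff.2 (by linarith)
  have h2 : Real.exp (-a * x) ≤ a⁻¹ * x⁻¹ := by
    rw [← mul_inv, neg_mul, Real.exp_neg]
    exact inv_anti₀ hax (by linarith [Real.add_one_le_exp (a*x)])
  rcases min_cases 1 x⁻¹ with ⟨h, _⟩ | ⟨h, _⟩ <;> rw [h]
  · rw [mul_one]; exact h1.trans (le_max_left _ _)
  · exact h2.trans (mul_le_mul_of_nonneg_right (le_max_right _ _) (by positivity))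

lemma lint_upper {a x : ℝ} (ha : 0 < a) (hx : 0 < x) :
    ∫⁻ q in Ioo (0:ℝ) 1, ENNReal.ofReal (Real.exp (-(a * q) * x)) ≤
      ENNReal.ofReal (max 1 a⁻¹) * ENNReal.ofReal (min 1 x⁻¹) := by
  have hax : 0 < a * x := by positivity
  have h1 : ∫⁻ q in Ioo (0:ℝ) 1, ENNReal.ofReal (Real.exp (-(a * q) * x)) ≤ ENNReal.ofReal 1 := by
    calc _ ≤ ∫⁻ q in Ioo (0:ℝ) 1, 1 := by
          refine setLIntegral_mono (by fun_prop) fun q hq => ?_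
          rw [← ENNReal.ofReal_one]
          refine ENNReal.ofReal_le_ofReal (Real.exp_le_one_iff.2 ?_)
          have := mul_pos (mul_pos ha hq.1) hx
          linarith
      _ = _ := by simp
  have h2 : ∫⁻ q in Ioo (0:ℝ) 1, ENNReal.ofReal (Real.exp (-(a * q) * x)) ≤
      ENNReal.ofReal (a⁻¹ * x⁻¹) := by
    calc _ ≤ ∫⁻ q in Ioi (0:ℝ), ENNReal.ofReal (Real.exp (-(a * q) * x)) :=
          lintegral_mono_set Ioo_subset_Ioi_self
      _ = ∫⁻ q in Ioi (0:ℝ), ENNReal.ofReal (Real.exp ((-(a * x)) * q)) := by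
          refine lintegral_congr fun q => ?_
          congr 2; ring
      _ = _ := by
          rw [← ofReal_integral_eq_lintegral_ofReal
            (integrableOn_exp_mul_Ioi (by linarith) 0)
            (Eventually.of_forall fun q => (Real.exp_pos _).le),
            integral_exp_mul_Ioi (by linarith)]
          congr 1
          simp [mul_comm]
  rw [← ENNReal.ofReal_mul (by positivity)]
  rcases min_cases 1 x⁻¹ with ⟨h, _⟩ | ⟨h, _⟩ <;> rw [h]
  · rw [mul_one]; exact h1.trans (ENNReal.ofReal_le_ofReal (le_max_left _ _))
  · exact h2.trans (ENNReal.ofReal_le_ofReal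
      (mul_le_mul_of_nonneg_right (le_max_right _ _) (by positivity)))

lemma lint_lower {x : ℝ} (hx : 0 < x) :
    ENNReal.ofReal (Real.exp (-1)) * ENNReal.ofReal (min 1 x⁻¹) ≤
      ∫⁻ q in Ioo (0:ℝ) 1, ENNReal.ofReal (Real.exp (-q * x)) := by
  calc _ = ∫⁻ q in Ioo (0:ℝ) (min 1 x⁻¹), ENNReal.ofReal (Real.exp (-1)) := by simp
    _ ≤ ∫⁻ q in Ioo (0:ℝ) (min 1 x⁻¹), ENNReal.ofReal (Real.exp (-q * x)) := by
      refine setLIntegral_mono (by fun_prop) fun q hq => ?_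
      refine ENNReal.ofReal_le_ofReal (Real.exp_le_exp.2 ?_)
      have h1 : q < x⁻¹ := hq.2.trans_le (min_le_right _ _)
      have h2 : q * x < 1 := (lt_mul_inv_iff₀ hx).1 (by simpa using h1)
      linarith
    _ ≤ _ := lintegral_mono_set (Ioo_subset_Ioo_right (min_le_left _ _))

lemma iter_dif_integral {μ : Measure ℝ} {h : ℝ} (hh : 0 < h) (n : ℕ) {K : ℝ → ℝ → ℝ}
    (hK : ∀ q > (0:ℝ), Integrable (fun x => K x q) μ) {q : ℝ} (hq : 0 < q) :
    (dif h)^[n] (fun q => ∫ x, K x q ∂μ) q = ∫ x, (dif h)^[n] (K x) q ∂μ := by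
  have main : ∀ n, ∀ q > (0:ℝ), Integrable (fun x => (dif h)^[n] (K x) q) μ ∧
      (dif h)^[n] (fun q => ∫ x, K x q ∂μ) q = ∫ x, (dif h)^[n] (K x) q ∂μ := by
    intro n
    induction n with
    | zero => exact fun q hq => ⟨hK q hq, rfl⟩
    | succ n ih =>
      intro q hq
      have a := ih q hq
      have b := ih (q+h) (by linarith)
      simp only [Function.iterate_succ_apply', dif]
      refine ⟨a.1.sub b.1, ?_⟩
      rw [integral_sub a.1 b.1, a.2, b.2]
  exact (main n q hq).2

lemma sfinite_of_min {μ : Measure ℝ} (hpos : ∀ᵐ x ∂μ, 0 < x)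
    (hμ : (∫⁻ x, ENNReal.ofReal (min 1 x⁻¹) ∂μ) < ⊤) : SFinite μ := by
  have hm : Measurable (fun x : ℝ => ENNReal.ofReal (min 1 x⁻¹)) := by fun_prop
  have : IsFiniteMeasure (μ.withDensity (fun x => ENNReal.ofReal (min 1 x⁻¹))) :=
    isFiniteMeasure_withDensity hμ.ne
  have e := withDensity_inv_same (μ := μ) hm (by
    filter_upwards [hpos] with x hx
    have : 0 < min 1 x⁻¹ := by positivity
    simpa using this) (Eventually.of_forall fun _ => ENNReal.ofReal_ne_top)
  rw [← e]
  infer_instance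

/-- If `f(q) = c + ∫ e^(-qx) μ(dx)` with `c ≥ 0` and
`∫ min(1,1/x) μ(dx) < ∞` (so `f ∈ B₁`), and `g` is a positive Bernstein function, then
`f ∘ g ∈ B₁`: there are `c' ≥ 0` and a measure `μ'` on `(0,∞)` with
`∫ min(1,1/x) μ'(dx) < ∞` such that `f(g(q)) = c' + ∫ e^(-qx) μ'(dx)` for `q > 0`. -/
theorem b1_comp_bernstein
    (c : ℝ) (hc : 0 ≤ c)
    (μ : Measure ℝ) (hμ0 : μ (Iic 0) = 0)
    (hμ : (∫⁻ x, ENNReal.ofReal (min 1 x⁻¹) ∂μ) < ⊤)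
    (f : ℝ → ℝ) (hf : ∀ q > (0:ℝ), f q = c + ∫ x, Real.exp (-q * x) ∂μ)
    (g : ℝ → ℝ) (hg : IsBernstein g) (hgpos : ∀ q > (0:ℝ), 0 < g q) :
    ∃ (c' : ℝ) (μ' : Measure ℝ), 0 ≤ c' ∧ μ' (Iic 0) = 0 ∧
      (∫⁻ x, ENNReal.ofReal (min 1 x⁻¹) ∂μ') < ⊤ ∧
      ∀ q > (0:ℝ), f (g q) = c' + ∫ x, Real.exp (-q * x) ∂μ' := by
  have hpos : ∀ᵐ x ∂μ, 0 < x := by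
    rw [ae_iff]
    convert hμ0 using 2
    ext x; simp
  have hsf := sfinite_of_min hpos hμ
  have hminint : Integrable (fun x : ℝ => min 1 x⁻¹) μ := by
    refine ⟨(by fun_prop : Measurable fun x : ℝ => min 1 x⁻¹).aestronglyMeasurable, ?_⟩
    rw [hasFiniteIntegral_iff_ofReal]
    · exact hμ
    · filter_upwards [hpos] with x hx
      show 0 ≤ min 1 x⁻¹
      positivity
  have hexp : ∀ a > (0:ℝ), Integrable (fun x => Real.exp (-a * x)) μ := by
    intro a ha
    refine (hminint.const_mul (max 1 a⁻¹)).mono'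
      (by fun_prop : Measurable fun x : ℝ => Real.exp (-a * x)).aestronglyMeasurable ?_
    filter_upwards [hpos] with x hx
    rw [Real.norm_of_nonneg (Real.exp_pos _).le]
    exact exp_neg_le_min ha hx
  obtain ⟨g', hg1, hg2⟩ := hg.deriv
  set F : ℝ → ℝ := fun q => ∫ x, Real.exp (-g q * x) ∂μ with hFdef
  have hF : DCM F := by
    intro h hh n q hq
    rw [hFdef, iter_dif_integral (K := fun x q => Real.exp (-g q * x)) hh n
      (fun q hq => hexp _ (hgpos q hq)) hq]
    apply integral_nonneg_of_ae
    filter_upwards [hpos] with x hx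
    have := AM.exp_neg hg1 hg2 hx.le (0 + n)
    exact (AM.iter_dif hh this) q hq
  have hFc : ContinuousOn F (Ioi 0) := by
    intro q hq
    apply ContinuousAt.continuousWithinAt
    have hgc : ContinuousAt g q := (hg1 q hq).continuousAt
    have hgq := hgpos q hq
    apply continuousAt_of_dominated (bound := fun x => Real.exp (-(g q / 2) * x))
    · exact Eventually.of_forall fun r =>
        (by fun_prop : Measurable fun x : ℝ => Real.exp (-g r * x)).aestronglyMeasurable
    · have : ∀ᶠ r in 𝓝 q, g q / 2 < g r := hgc.eventually_const_lt (by linarith)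
      filter_upwards [this] with r hr
      filter_upwards [hpos] with x hx
      rw [Real.norm_of_nonneg (Real.exp_pos _).le]
      apply Real.exp_le_exp.2
      nlinarith
    · exact hexp _ (by linarith)
    · refine Eventually.of_forall fun x => ?_
      exact Real.continuous_exp.continuousAt.comp (hgc.neg.mul continuousAt_const)
  obtain ⟨ρ, hρs, hρ0, hρ⟩ := hF.bernstein hFc
  have hFnn : ∀ q, 0 ≤ F q := fun q => integral_nonneg fun x => (Real.exp_pos _).le
  -- decomposition
  have hdec : ∀ q, ∫⁻ x, ENNReal.ofReal (Real.exp (-q * x)) ∂ρ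
      = ρ {0} + ∫⁻ x in Ioi 0, ENNReal.ofReal (Real.exp (-q * x)) ∂ρ := by
    intro q
    have h1 : ρ = ρ.restrict (Ici 0) := by
      symm
      apply Measure.restrict_eq_self_of_ae_mem
      rw [ae_iff]
      convert hρ0 using 2
      ext x; simp
    conv_lhs => rw [h1]
    rw [← Ioi_insert, insert_eq, lintegral_union measurableSet_Ioi (by simp)]
    simp
  have hfin0 : ρ {0} ≠ ⊤ := by
    have := hρ 1 one_pos
    rw [hdec 1] at this
    intro h
    rw [h] at this
    simp at this
  refine ⟨c + (ρ {0}).toReal, ρ.restrict (Ioi 0), by positivity, ?_, ?_, ?_⟩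
  · rw [Measure.restrict_apply measurableSet_Iic]
    have : Iic (0:ℝ) ∩ Ioi 0 = ∅ := by ext x; simp
    rw [this, measure_empty]
  · -- the integrability condition
    have hb : ENNReal.ofReal (Real.exp (-1)) * ∫⁻ x in Ioi 0, ENNReal.ofReal (min 1 x⁻¹) ∂ρ < ⊤ := by
      have ha : 0 < g 1 / 2 := half_pos (hgpos 1 one_pos)
      calc ENNReal.ofReal (Real.exp (-1)) * ∫⁻ x in Ioi 0, ENNReal.ofReal (min 1 x⁻¹) ∂ρ
          = ∫⁻ x in Ioi 0, ENNReal.ofReal (Real.exp (-1)) * ENNReal.ofReal (min 1 x⁻¹) ∂ρ :=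
            (lintegral_const_mul _ (by fun_prop)).symm
        _ ≤ ∫⁻ x in Ioi 0, (∫⁻ q in Ioo (0:ℝ) 1, ENNReal.ofReal (Real.exp (-q * x))) ∂ρ :=
            setLIntegral_mono' measurableSet_Ioi fun x hx => lint_lower hx
        _ ≤ ∫⁻ x, (∫⁻ q in Ioo (0:ℝ) 1, ENNReal.ofReal (Real.exp (-q * x))) ∂ρ :=
            setLIntegral_le_lintegral _ _
        _ = ∫⁻ q in Ioo (0:ℝ) 1, (∫⁻ x, ENNReal.ofReal (Real.exp (-q * x)) ∂ρ) :=
            lintegral_lintegral_swap (by fun_prop)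
        _ ≤ ∫⁻ q in Ioo (0:ℝ) 1, (∫⁻ x, ENNReal.ofReal (Real.exp (-(g 1 / 2 * q) * x)) ∂μ) := by
            refine setLIntegral_mono' measurableSet_Ioo fun q hq => ?_
            rw [hρ q hq.1, hFdef]
            simp only
            rw [ofReal_integral_eq_lintegral_ofReal (hexp _ (hgpos q hq.1))
              (Eventually.of_forall fun x => (Real.exp_pos _).le)]
            refine lintegral_mono_ae ?_
            filter_upwards [hpos] with x hx
            refine ENNReal.ofReal_le_ofReal (Real.exp_le_exp.2 ?_)
            have := concave_bound hg1 hg2 hgpos hq.1 hq.2.le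
            nlinarith
        _ = ∫⁻ x, (∫⁻ q in Ioo (0:ℝ) 1, ENNReal.ofReal (Real.exp (-(g 1 / 2 * q) * x))) ∂μ :=
            lintegral_lintegral_swap (by fun_prop)
        _ ≤ ∫⁻ x, ENNReal.ofReal (max 1 (g 1 / 2)⁻¹) * ENNReal.ofReal (min 1 x⁻¹) ∂μ := by
            refine lintegral_mono_ae ?_
            filter_upwards [hpos] with x hx
            exact lint_upper ha hx
        _ = ENNReal.ofReal (max 1 (g 1 / 2)⁻¹) * ∫⁻ x, ENNReal.ofReal (min 1 x⁻¹) ∂μ :=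
            lintegral_const_mul _ (by fun_prop)
        _ < ⊤ := ENNReal.mul_lt_top ENNReal.ofReal_lt_top hμ
    by_contra hcon
    rw [not_lt, top_le_iff] at hcon
    rw [hcon, ENNReal.mul_top (by simp [Real.exp_pos])] at hb
    exact lt_irrefl _ hb
  · intro q hq
    rw [hf _ (hgpos q hq)]
    have h1 := hρ q hq
    rw [hdec q] at h1
    have h2 := congrArg ENNReal.toReal h1
    have h3 : ∫⁻ x in Ioi 0, ENNReal.ofReal (Real.exp (-q * x)) ∂ρ ≠ ⊤ := by
      intro h
      rw [h] at h1
      simp at h1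
    rw [ENNReal.toReal_add hfin0 h3, ENNReal.toReal_ofReal (hFnn q)] at h2
    rw [integral_eq_lintegral_of_nonneg_ae (f := fun x => Real.exp (-q * x))
      (Eventually.of_forall fun x => (Real.exp_pos _).le)
      (by fun_prop : Measurable fun x : ℝ => Real.exp (-q * x)).aestronglyMeasurable]
    show c + F q = _
    rw [← h2]; ring
end
end
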